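/- Every (7,4)-configuration is isomorphic to the configuration described by the four 4-cycles (a,b,c,d), (a,e,b,f), (c,f,d,g), (a,c,e,g), where a,b,c,d,e,f,g are seven distinct vertices. -/

import Mathlib

open Finset

/-- The edge set of the 4-cycle `(a, b, c, d)`: edges {a,b}, {b,c}, {c,d}, {d,a}. -/
def cycEdges {V : Type*} [DecidableEq V] (a b c d : V) : Finset (Sym2 V) :=
  {s(a, b), s(b, c), s(c, d), s(d, a)}

/-- `E` is the edge set of a 4-cycle on four distinct vertices. -/
def IsFourCycle {V : Type*} [DecidableEq V] (E : Finset (Sym2 V)) : Prop :=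
  ∃ a b c d : V, ([a, b, c, d] : List V).Nodup ∧ E = cycEdges a b c d

/-- The set of vertices covered by a set of edges. -/
def edgeVerts {V : Type*} [DecidableEq V] (E : Finset (Sym2 V)) : Finset V :=
  E.sup (Sym2.lift ⟨fun x y => ({x, y} : Finset V), fun x y => Finset.pair_comm x y⟩)

/-- A `(k, l)`-configuration: a set of `l` pairwise edge-disjoint 4-cycles whose
union contains exactly `k` vertices. -/
def IsConfiguration {V : Type*} [DecidableEq V] (k l : ℕ)
    (D : Finset (Finset (Sym2 V))) : Prop :=
  D.card = l ∧ (∀ E ∈ D, IsFourCycle E) ∧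
    (∀ E ∈ D, ∀ F ∈ D, E ≠ F → Disjoint E F) ∧
    (D.sup edgeVerts).card = k

/-- `C` is a 4-cycle system: a collection of 4-cycles whose edge sets partition
the edge set of the complete graph on `V`. -/
def IsFourCycleSystem {V : Type*} [DecidableEq V] (C : Finset (Finset (Sym2 V))) : Prop :=
  (∀ E ∈ C, IsFourCycle E) ∧ ∀ e : Sym2 V, ¬ e.IsDiag → ∃! E, E ∈ C ∧ e ∈ E

/-- `C` is a 4-cycle packing: a set of pairwise edge-disjoint 4-cycles. -/
def IsFourCyclePacking {V : Type*} [DecidableEq V] (C : Finset (Finset (Sym2 V))) : Prop :=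
  (∀ E ∈ C, IsFourCycle E) ∧ ∀ E ∈ C, ∀ F ∈ C, E ≠ F → Disjoint E F

/-- `C` is `r`-sparse: it contains no `(j+3, j)`-configuration for `2 ≤ j ≤ r`. -/
def RSparse {V : Type*} [DecidableEq V] (r : ℕ) (C : Finset (Finset (Sym2 V))) : Prop :=
  ∀ j, 2 ≤ j → j ≤ r → ∀ D ⊆ C, ¬ IsConfiguration (j + 3) j D

/-- Two 4-cycles form a double-diamond: they are `(a,b,c,d)` and `(a,e,c,f)`,
sharing the diagonal {a,c}. -/
def IsDoubleDiamond {V : Type*} [DecidableEq V] (E F : Finset (Sym2 V)) : Prop :=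
  ∃ a b c d e f : V, ([a, b, c, d, e, f] : List V).Nodup ∧
    E = cycEdges a b c d ∧ F = cycEdges a e c f

/-- `C` is D-avoiding: no two of its 4-cycles form a double-diamond. -/
def DAvoiding {V : Type*} [DecidableEq V] (C : Finset (Finset (Sym2 V))) : Prop :=
  ∀ E ∈ C, ∀ F ∈ C, ¬ IsDoubleDiamond E F

/-- `C` is strictly `r`-sparse: `r`-sparse and D-avoiding. -/
def StrictlyRSparse {V : Type*} [DecidableEq V] (r : ℕ)
    (C : Finset (Finset (Sym2 V))) : Prop :=
  RSparse r C ∧ DAvoiding C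

/-- Rotate a 4-tuple unless its first entry is the least one. -/
def rotMin (t : ℕ × ℕ × ℕ × ℕ) : ℕ × ℕ × ℕ × ℕ :=
  bif Nat.blt t.1 t.2.1 && Nat.blt t.1 t.2.2.1 && Nat.blt t.1 t.2.2.2 then t
  else (t.2.1, t.2.2.1, t.2.2.2, t.1)

/-- Reflect a 4-tuple so that the second entry is less than the last one. -/
def flipMin (t : ℕ × ℕ × ℕ × ℕ) : ℕ × ℕ × ℕ × ℕ :=
  bif Nat.blt t.2.1 t.2.2.2 then t else (t.1, t.2.2.2, t.2.2.1, t.2.1)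

/-- Canonical representative of a 4-cycle. -/
def canonCyc (t : ℕ × ℕ × ℕ × ℕ) : ℕ × ℕ × ℕ × ℕ :=
  flipMin (rotMin (rotMin (rotMin t)))

/-- Numerical code of a 4-tuple of numbers below 7. -/
def codeCyc (t : ℕ × ℕ × ℕ × ℕ) : ℕ := ((t.1 * 7 + t.2.1) * 7 + t.2.2.1) * 7 + t.2.2.2

def decodeCyc (n : ℕ) : ℕ × ℕ × ℕ × ℕ := (n / 343, n / 49 % 7, n / 7 % 7, n % 7)

/-- Boolean test that the edges `xy` and `zw` differ. -/
def edgeNe (x y z w : ℕ) : Bool :=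
  !((Nat.beq x z && Nat.beq y w) || (Nat.beq x w && Nat.beq y z))

def edgeOff (x y : ℕ) (u : ℕ × ℕ × ℕ × ℕ) : Bool :=
  edgeNe x y u.1 u.2.1 && (edgeNe x y u.2.1 u.2.2.1 && (edgeNe x y u.2.2.1 u.2.2.2 &&
    edgeNe x y u.2.2.2 u.1))

/-- Boolean test for edge-disjointness of 4-cycles. -/
def disjCyc (t u : ℕ × ℕ × ℕ × ℕ) : Bool :=
  edgeOff t.1 t.2.1 u && (edgeOff t.2.1 t.2.2.1 u && (edgeOff t.2.2.1 t.2.2.2 u &&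
    edgeOff t.2.2.2 t.1 u))

/-- Codes of the canonical 4-cycles on `0, …, 6` edge-disjoint from `(0,1,2,3)`. -/
def cycList : List ℕ :=
  [131, 132, 137, 139, 144, 145, 208, 209, 215, 216, 222, 223, 237, 243, 258, 265, 272, 279, 523,
  524, 529, 531, 536, 537, 558, 559, 565, 566, 580, 586, 608, 615, 622, 908, 909, 923, 929, 958,
  965, 1266, 1272, 1308]

/-- Labellings of the target configuration that contain the cycle `(0,1,2,3)`. -/
def labelList : List (ℕ × ℕ × ℕ × ℕ × ℕ × ℕ × ℕ) :=
  [(0, 1, 2, 3, 4, 5, 6), (0, 1, 2, 3, 4, 6, 5), (0, 1, 2, 3, 5, 4, 6), (0, 1, 2, 3, 5, 6, 4), (0,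
  1, 2, 3, 6, 4, 5), (0, 1, 2, 3, 6, 5, 4), (0, 2, 4, 5, 1, 3, 6), (0, 2, 4, 5, 3, 1, 6), (0, 2,
  4, 6, 1, 3, 5), (0, 2, 4, 6, 3, 1, 5), (0, 2, 5, 4, 1, 3, 6), (0, 2, 5, 4, 3, 1, 6), (0, 2, 5,
  6, 1, 3, 4), (0, 2, 5, 6, 3, 1, 4), (0, 2, 6, 4, 1, 3, 5), (0, 2, 6, 4, 3, 1, 5), (0, 2, 6, 5,
  1, 3, 4), (0, 2, 6, 5, 3, 1, 4), (0, 3, 2, 1, 4, 5, 6), (0, 3, 2, 1, 4, 6, 5), (0, 3, 2, 1, 5,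
  4, 6), (0, 3, 2, 1, 5, 6, 4), (0, 3, 2, 1, 6, 4, 5), (0, 3, 2, 1, 6, 5, 4), (0, 4, 1, 5, 2, 6,
  3), (0, 4, 1, 6, 2, 5, 3), (0, 4, 3, 5, 2, 6, 1), (0, 4, 3, 6, 2, 5, 1), (0, 5, 1, 4, 2, 6, 3),
  (0, 5, 1, 6, 2, 4, 3), (0, 5, 3, 4, 2, 6, 1), (0, 5, 3, 6, 2, 4, 1), (0, 6, 1, 4, 2, 5, 3), (0,
  6, 1, 5, 2, 4, 3), (0, 6, 3, 4, 2, 5, 1), (0, 6, 3, 5, 2, 4, 1), (1, 0, 3, 2, 4, 5, 6), (1, 0,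
  3, 2, 4, 6, 5), (1, 0, 3, 2, 5, 4, 6), (1, 0, 3, 2, 5, 6, 4), (1, 0, 3, 2, 6, 4, 5), (1, 0, 3,
  2, 6, 5, 4), (1, 2, 3, 0, 4, 5, 6), (1, 2, 3, 0, 4, 6, 5), (1, 2, 3, 0, 5, 4, 6), (1, 2, 3, 0,
  5, 6, 4), (1, 2, 3, 0, 6, 4, 5), (1, 2, 3, 0, 6, 5, 4), (1, 3, 4, 5, 0, 2, 6), (1, 3, 4, 5, 2,
  0, 6), (1, 3, 4, 6, 0, 2, 5), (1, 3, 4, 6, 2, 0, 5), (1, 3, 5, 4, 0, 2, 6), (1, 3, 5, 4, 2, 0,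
  6), (1, 3, 5, 6, 0, 2, 4), (1, 3, 5, 6, 2, 0, 4), (1, 3, 6, 4, 0, 2, 5), (1, 3, 6, 4, 2, 0, 5),
  (1, 3, 6, 5, 0, 2, 4), (1, 3, 6, 5, 2, 0, 4), (1, 4, 2, 5, 3, 6, 0), (1, 4, 2, 6, 3, 5, 0), (1,
  5, 2, 4, 3, 6, 0), (1, 5, 2, 6, 3, 4, 0), (1, 6, 2, 4, 3, 5, 0), (1, 6, 2, 5, 3, 4, 0), (2, 0,
  4, 5, 1, 3, 6), (2, 0, 4, 5, 3, 1, 6), (2, 0, 4, 6, 1, 3, 5), (2, 0, 4, 6, 3, 1, 5), (2, 0, 5,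
  4, 1, 3, 6), (2, 0, 5, 4, 3, 1, 6), (2, 0, 5, 6, 1, 3, 4), (2, 0, 5, 6, 3, 1, 4), (2, 0, 6, 4,
  1, 3, 5), (2, 0, 6, 4, 3, 1, 5), (2, 0, 6, 5, 1, 3, 4), (2, 0, 6, 5, 3, 1, 4), (2, 4, 3, 5, 0,
  6, 1), (2, 4, 3, 6, 0, 5, 1), (2, 5, 3, 4, 0, 6, 1), (2, 5, 3, 6, 0, 4, 1), (2, 6, 3, 4, 0, 5,
  1), (2, 6, 3, 5, 0, 4, 1), (3, 1, 4, 5, 0, 2, 6), (3, 1, 4, 5, 2, 0, 6), (3, 1, 4, 6, 0, 2, 5),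
  (3, 1, 4, 6, 2, 0, 5), (3, 1, 5, 4, 0, 2, 6), (3, 1, 5, 4, 2, 0, 6), (3, 1, 5, 6, 0, 2, 4), (3,
  1, 5, 6, 2, 0, 4), (3, 1, 6, 4, 0, 2, 5), (3, 1, 6, 4, 2, 0, 5), (3, 1, 6, 5, 0, 2, 4), (3, 1,
  6, 5, 2, 0, 4)]

/-- The four codes of a labelled target configuration. -/
def labelCodes : ℕ × ℕ × ℕ × ℕ × ℕ × ℕ × ℕ → List ℕ
  | (a, b, c, d, e, f, g) => [codeCyc (canonCyc (a, b, c, d)), codeCyc (canonCyc (a, e, b, f)),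
      codeCyc (canonCyc (c, f, d, g)), codeCyc (canonCyc (a, c, e, g))]

def memNat (n : ℕ) : List ℕ → Bool
  | [] => false
  | m :: l => bif Nat.beq n m then true else memNat n l

def goodLabel (r s t : ℕ) (w : ℕ × ℕ × ℕ × ℕ × ℕ × ℕ × ℕ) : Bool :=
  memNat r (labelCodes w) && (memNat s (labelCodes w) && (memNat t (labelCodes w) &&
    memNat 66 (labelCodes w)))

def disjCode (r s : ℕ) : Bool := disjCyc (decodeCyc r) (decodeCyc s)

theorem search_ok : (cycList.all fun r => cycList.all fun s => bif disjCode r s then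
    (cycList.all fun t => bif disjCode r t && disjCode s t then
      labelList.any (goodLabel r s t) else true) else true) = true := by
  decide +kernel

theorem canon_mem : ∀ i j k l : Fin 7, [i, j, k, l].Nodup →
    disjCyc (0, 1, 2, 3) (i.1, j.1, k.1, l.1) = true →
    codeCyc (canonCyc (i.1, j.1, k.1, l.1)) ∈ cycList ∧
    decodeCyc (codeCyc (canonCyc (i.1, j.1, k.1, l.1))) = canonCyc (i.1, j.1, k.1, l.1) := by
  decide +kernel

theorem label_ok : ∀ w ∈ labelList, [w.1, w.2.1, w.2.2.1, w.2.2.2.1, w.2.2.2.2.1, w.2.2.2.2.2.1,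
    w.2.2.2.2.2.2].Nodup ∧ ∀ x ∈ [w.1, w.2.1, w.2.2.1, w.2.2.2.1, w.2.2.2.2.1, w.2.2.2.2.2.1,
    w.2.2.2.2.2.2], x < 7 := by
  decide +kernel

theorem label_decode : ∀ w ∈ labelList,
    (labelCodes w).map decodeCyc = [canonCyc (w.1, w.2.1, w.2.2.1, w.2.2.2.1),
      canonCyc (w.1, w.2.2.2.2.1, w.2.1, w.2.2.2.2.2.1),
      canonCyc (w.2.2.1, w.2.2.2.2.2.1, w.2.2.2.1, w.2.2.2.2.2.2),
      canonCyc (w.1, w.2.2.1, w.2.2.2.2.1, w.2.2.2.2.2.2)] := by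
  decide +kernel

/-- The cycle obtained from a tuple by the labelling `f`. -/
def cycOf {V : Type*} [DecidableEq V] (f : ℕ → V) (t : ℕ × ℕ × ℕ × ℕ) : Finset (Sym2 V) :=
  cycEdges (f t.1) (f t.2.1) (f t.2.2.1) (f t.2.2.2)

theorem cycEdges_rot {V : Type*} [DecidableEq V] (a b c d : V) :
    cycEdges b c d a = cycEdges a b c d := by
  ext e
  simp only [cycEdges, Finset.mem_insert, Finset.mem_singleton]
  tauto

theorem cycEdges_flip {V : Type*} [DecidableEq V] (a b c d : V) :
    cycEdges a d c b = cycEdges a b c d := by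
  ext e
  simp only [cycEdges, Finset.mem_insert, Finset.mem_singleton]
  rw [Sym2.eq_swap (a := a) (b := d), Sym2.eq_swap (a := d) (b := c),
    Sym2.eq_swap (a := c) (b := b), Sym2.eq_swap (a := b) (b := a)]
  tauto

theorem cycOf_rotMin {V : Type*} [DecidableEq V] (f : ℕ → V) (t : ℕ × ℕ × ℕ × ℕ) :
    cycOf f (rotMin t) = cycOf f t := by
  unfold rotMin
  cases (Nat.blt t.1 t.2.1 && Nat.blt t.1 t.2.2.1 && Nat.blt t.1 t.2.2.2)
  · exact cycEdges_rot _ _ _ _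
  · rfl

theorem cycOf_flipMin {V : Type*} [DecidableEq V] (f : ℕ → V) (t : ℕ × ℕ × ℕ × ℕ) :
    cycOf f (flipMin t) = cycOf f t := by
  unfold flipMin
  cases (Nat.blt t.2.1 t.2.2.2)
  · exact cycEdges_flip _ _ _ _
  · rfl

theorem cycOf_canon {V : Type*} [DecidableEq V] (f : ℕ → V) (t : ℕ × ℕ × ℕ × ℕ) :
    cycOf f (canonCyc t) = cycOf f t := by
  simp only [canonCyc, cycOf_flipMin, cycOf_rotMin]

theorem edgeNe_of_ne {V : Type*} (f : ℕ → V) (x y z w : ℕ)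
    (h : s(f x, f y) ≠ s(f z, f w)) : edgeNe x y z w = true := by
  by_contra hc
  apply h
  simp only [edgeNe, Bool.not_eq_true', Bool.not_eq_false, Bool.or_eq_true,
    Bool.and_eq_true, Nat.beq_eq] at hc
  rcases hc with ⟨rfl, rfl⟩ | ⟨rfl, rfl⟩
  · rfl
  · exact Sym2.eq_swap

theorem disjCyc_of_disjoint {V : Type*} [DecidableEq V] (f : ℕ → V) (t u : ℕ × ℕ × ℕ × ℕ)
    (h : Disjoint (cycOf f t) (cycOf f u)) : disjCyc t u = true := by
  have key : ∀ x y, s(f x, f y) ∈ cycOf f t → edgeOff x y u = true := by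
    intro x y hxy
    have h2 : ∀ z w, s(f z, f w) ∈ cycOf f u → edgeNe x y z w = true := fun z w hz =>
      edgeNe_of_ne f x y z w (fun he => Finset.disjoint_left.1 h hxy (he ▸ hz))
    unfold edgeOff
    rw [h2, h2, h2, h2] <;> simp [cycOf, cycEdges]
  unfold disjCyc
  rw [key, key, key, key] <;> simp [cycOf, cycEdges]

theorem edgeVerts_cycEdges {V : Type*} [DecidableEq V] (a b c d : V) :
    edgeVerts (cycEdges a b c d) = {a, b, c, d} := by
  ext x
  simp only [edgeVerts, cycEdges, Finset.sup_insert, Finset.sup_singleton, Sym2.lift_mk,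
    Finset.sup_eq_union, Finset.mem_union, Finset.mem_insert, Finset.mem_singleton]
  tauto

theorem exists_code {V : Type*} [DecidableEq V] (f : ℕ → V) (E : Finset (Sym2 V))
    (hE : IsFourCycle E) (hv : ∀ v ∈ edgeVerts E, ∃ i : Fin 7, f i.1 = v)
    (hd : Disjoint (cycOf f (0, 1, 2, 3)) E) :
    ∃ n ∈ cycList, E = cycOf f (decodeCyc n) := by
  obtain ⟨p, q, r, s, hn, rfl⟩ := hE
  rw [edgeVerts_cycEdges] at hv
  obtain ⟨i, rfl⟩ := hv p (by simp)
  obtain ⟨j, rfl⟩ := hv q (by simp)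
  obtain ⟨k, rfl⟩ := hv r (by simp)
  obtain ⟨l, rfl⟩ := hv s (by simp)
  have hn' : [i, j, k, l].Nodup :=
    List.Nodup.of_map (fun i : Fin 7 => f i.1) (by simpa using hn)
  have hm := canon_mem i j k l hn' (disjCyc_of_disjoint f _ _ hd)
  refine ⟨_, hm.1, ?_⟩
  rw [hm.2, cycOf_canon]
  rfl

theorem memNat_mem (n : ℕ) (l : List ℕ) (h : memNat n l = true) : n ∈ l := by
  induction l with
  | nil => simp [memNat] at h
  | cons m l ih =>
    unfold memNat at h
    cases hb : Nat.beq n m with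
    | true => exact List.mem_cons.2 (Or.inl (Nat.eq_of_beq_eq_true hb))
    | false =>
      rw [hb] at h
      exact List.mem_cons_of_mem _ (ih h)

/-- Every `(7,4)`-configuration has the form
`{(a,b,c,d), (a,e,b,f), (c,f,d,g), (a,c,e,g)}` on seven distinct vertices. -/
theorem seven_four_configuration_classification {V : Type*} [DecidableEq V]
    (A : Finset (Finset (Sym2 V))) (hA : IsConfiguration 7 4 A) :
    ∃ a b c d e f g : V, ([a, b, c, d, e, f, g] : List V).Nodup ∧
      A = {cycEdges a b c d, cycEdges a e b f, cycEdges c f d g, cycEdges a c e g} := by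
  obtain ⟨hc, hcyc, hdis, hk⟩ := hA
  obtain ⟨E₀, E₁, E₂, E₃, h01, h02, h03, h12, h13, h23, rfl⟩ := Finset.card_eq_four.1 hc
  obtain ⟨a, b, c, d, hn, hE₀⟩ := hcyc E₀ (by simp)
  set S := ({E₀, E₁, E₂, E₃} : Finset (Finset (Sym2 V))).sup edgeVerts with hS
  have hsub : ∀ E ∈ ({E₀, E₁, E₂, E₃} : Finset (Finset (Sym2 V))), edgeVerts E ⊆ S :=
    fun E hE => Finset.le_sup (f := edgeVerts) hE
  have h4 : ({a, b, c, d} : Finset V) ⊆ S := by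
    rw [← edgeVerts_cycEdges, ← hE₀]
    exact hsub _ (by simp)
  have h4c : ({a, b, c, d} : Finset V).card = 4 := by
    have := List.toFinset_card_of_nodup hn
    simpa using this
  have h3c : (S \ {a, b, c, d}).card = 3 := by
    rw [Finset.card_sdiff_of_subset h4, h4c, hk]
  obtain ⟨x, y, z, hxy, hxz, hyz, h3⟩ := Finset.card_eq_three.1 h3c
  have hx : x ∉ ({a, b, c, d} : Finset V) :=
    (Finset.mem_sdiff.1 (h3 ▸ (by simp) : x ∈ S \ {a, b, c, d})).2
  have hy : y ∉ ({a, b, c, d} : Finset V) :=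
    (Finset.mem_sdiff.1 (h3 ▸ (by simp) : y ∈ S \ {a, b, c, d})).2
  have hz : z ∉ ({a, b, c, d} : Finset V) :=
    (Finset.mem_sdiff.1 (h3 ▸ (by simp) : z ∈ S \ {a, b, c, d})).2
  have hnod : [a, b, c, d, x, y, z].Nodup := by
    simp only [Finset.mem_insert, Finset.mem_singleton, not_or] at hx hy hz
    simp only [List.nodup_cons, List.mem_cons, List.not_mem_nil, or_false, not_or,
      List.nodup_nil, and_true, not_false_eq_true] at hn ⊢
    grind
  let f : ℕ → V := fun n => [a, b, c, d, x, y, z].getD n a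
  have hfS : ∀ v ∈ S, ∃ i : Fin 7, f i.1 = v := by
    intro v hv
    by_cases h : v ∈ ({a, b, c, d} : Finset V)
    · simp only [Finset.mem_insert, Finset.mem_singleton] at h
      rcases h with rfl | rfl | rfl | rfl
      exacts [⟨0, rfl⟩, ⟨1, rfl⟩, ⟨2, rfl⟩, ⟨3, rfl⟩]
    · have h' : v ∈ S \ {a, b, c, d} := Finset.mem_sdiff.2 ⟨hv, h⟩
      rw [h3] at h'
      simp only [Finset.mem_insert, Finset.mem_singleton] at h'
      rcases h' with rfl | rfl | rfl
      exacts [⟨4, rfl⟩, ⟨5, rfl⟩, ⟨6, rfl⟩]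
  have hfinj : ∀ i j, i < 7 → j < 7 → f i = f j → i = j := by
    intro i j hi hj hij
    have hi' : i < [a, b, c, d, x, y, z].length := hi
    have hj' : j < [a, b, c, d, x, y, z].length := hj
    simp only [f, List.getD_eq_getElem _ _ hi', List.getD_eq_getElem _ _ hj'] at hij
    exact (List.Nodup.getElem_inj_iff hnod).1 hij
  have hE₀f : E₀ = cycOf f (0, 1, 2, 3) := hE₀
  have hcode : ∀ E ∈ ({E₀, E₁, E₂, E₃} : Finset (Finset (Sym2 V))), E₀ ≠ E →
      ∃ n ∈ cycList, E = cycOf f (decodeCyc n) := fun E hE hne =>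
    exists_code f E (hcyc E hE) (fun v hv => hfS v (hsub E hE hv))
      (hE₀f ▸ hdis E₀ (by simp) E hE hne)
  obtain ⟨r, hr, hE₁⟩ := hcode E₁ (by simp) h01
  obtain ⟨s, hs, hE₂⟩ := hcode E₂ (by simp) h02
  obtain ⟨t, ht, hE₃⟩ := hcode E₃ (by simp) h03
  have d12 : disjCode r s = true :=
    disjCyc_of_disjoint f _ _ (hE₁ ▸ hE₂ ▸ hdis E₁ (by simp) E₂ (by simp) h12)
  have d13 : disjCode r t = true :=
    disjCyc_of_disjoint f _ _ (hE₁ ▸ hE₃ ▸ hdis E₁ (by simp) E₃ (by simp) h13)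
  have d23 : disjCode s t = true :=
    disjCyc_of_disjoint f _ _ (hE₂ ▸ hE₃ ▸ hdis E₂ (by simp) E₃ (by simp) h23)
  have h1 := List.all_eq_true.1 (List.all_eq_true.1 search_ok r hr) s hs
  rw [d12, cond_true] at h1
  have h2 := List.all_eq_true.1 h1 t ht
  rw [d13, d23, Bool.and_self, cond_true] at h2
  obtain ⟨w, hw, hg⟩ := List.any_eq_true.1 h2
  simp only [goodLabel, Bool.and_eq_true] at hg
  obtain ⟨g1, g2, g3, g0⟩ := hg
  have hl := label_ok w hw
  have hdec := label_decode w hw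
  obtain ⟨p1, p2, p3, p4, p5, p6, p7⟩ := w
  have hmem : ∀ n, memNat n (labelCodes (p1, p2, p3, p4, p5, p6, p7)) = true →
      cycOf f (decodeCyc n) ∈ ({cycEdges (f p1) (f p2) (f p3) (f p4),
        cycEdges (f p1) (f p5) (f p2) (f p6), cycEdges (f p3) (f p6) (f p4) (f p7),
        cycEdges (f p1) (f p3) (f p5) (f p7)} : Finset (Finset (Sym2 V))) := by
    intro n hn
    have hn2 := List.mem_map_of_mem (f := decodeCyc) (memNat_mem _ _ hn)
    rw [hdec] at hn2
    simp only [List.mem_cons, List.not_mem_nil, or_false] at hn2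
    simp only [Finset.mem_insert, Finset.mem_singleton]
    rcases hn2 with h | h | h | h <;> rw [h, cycOf_canon]
    exacts [Or.inl rfl, Or.inr (Or.inl rfl), Or.inr (Or.inr (Or.inl rfl)),
      Or.inr (Or.inr (Or.inr rfl))]
  refine ⟨f p1, f p2, f p3, f p4, f p5, f p6, f p7, ?_, ?_⟩
  · exact List.Nodup.map_on (f := f)
      (fun i hi j hj h => hfinj i j (hl.2 i hi) (hl.2 j hj) h) hl.1
  · apply Finset.eq_of_subset_of_card_le
    · intro E hE
      simp only [Finset.mem_insert, Finset.mem_singleton] at hE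
      rcases hE with h | h | h | h <;> rw [h]
      · rw [hE₀f]
        exact hmem 66 g0
      · rw [hE₁]
        exact hmem r g1
      · rw [hE₂]
        exact hmem s g2
      · rw [hE₃]
        exact hmem t g3
    · rw [hc]
      exact Finset.card_le_four
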